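/- Fix a real z_0 > 0. For Lebesgue-almost every irrational x ∈ (0,1): the set K := {n ≥ 0 : Θ_n(x) ≤ z_0} is infinite, where Θ_n(x) := s_n(x) · |s_n(x)·x − u_n(x)|, and enumerating K increasingly as n_0 < n_1 < ⋯, for every z with 0 ≤ z ≤ z_0 the limit lim_{m→∞} (1/m) · #{0 ≤ k < m : Θ_{n_k}(x) ≤ z} exists and equals: z/z_0 if z_0 ≤ 1; z/(1 + log z_0) if z ≤ 1 ≤ z_0; (1 + log z)/(1 + log z_0) if 1 ≤ z ≤ z_0. -/

import Mathlib

open MeasureTheory Filter Topology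
open scoped Classical

noncomputable section

/-- The Farey tent map `F`. -/
def fareyMap (x : ℝ) : ℝ := if x ≤ 1/2 then x / (1 - x) else (1 - x) / x

/-- `eps x n = ε_{n+1}(x)`, i.e. `0` if `F^[n] x ≤ 1/2` and `1` otherwise. -/
def eps (x : ℝ) (n : ℕ) : ℤ := if fareyMap^[n] x ≤ 1/2 then 0 else 1

/-- The matrices `A_0 = [[1,0],[1,1]]` and `A_1 = [[0,1],[1,1]]`. -/
def Amat (e : ℤ) : Matrix (Fin 2) (Fin 2) ℤ := !![1 - e, e; 1, 1]

/-- `Mmat x n = A_{ε_1(x)} ⋯ A_{ε_n(x)}`, with `Mmat x 0` the identity. -/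
def Mmat (x : ℝ) : ℕ → Matrix (Fin 2) (Fin 2) ℤ
  | 0 => 1
  | n + 1 => Mmat x n * Amat (eps x n)

/-- `u_n(x)`: top-left entry of `M_n(x)`. -/
def uF (x : ℝ) (n : ℕ) : ℤ := Mmat x n 0 0

/-- `s_n(x)`: bottom-left entry of `M_n(x)`. -/
def sF (x : ℝ) (n : ℕ) : ℤ := Mmat x n 1 0

/-- Ito's natural extension `F̄` of the Farey tent map. -/
def fareyNE (p : ℝ × ℝ) : ℝ × ℝ :=
  if p.1 ≤ 1/2 then (p.1 / (1 - p.1), p.2 / (1 + p.2))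
  else ((1 - p.1) / p.1, 1 / (1 + p.2))

/-- `Ω = [0,1]²`. -/
def OmegaSet : Set (ℝ × ℝ) := Set.Icc (0:ℝ) 1 ×ˢ Set.Icc (0:ℝ) 1

/-- The measure `μ̄` on `Ω` with density `(x + y − xy)⁻²` w.r.t. Lebesgue measure. -/
def muBar : Measure (ℝ × ℝ) :=
  (volume.restrict OmegaSet).withDensity
    (fun p => ENNReal.ofReal (1 / (p.1 + p.2 - p.1 * p.2) ^ 2))

/-- A proper inducible subregion of `Ω`. -/
def ProperInducible (R : Set (ℝ × ℝ)) : Prop :=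
  R ⊆ OmegaSet ∧ MeasurableSet R ∧ 0 < muBar R ∧ muBar R < ⊤ ∧ muBar (frontier R) = 0

/-- `hitsR R x k` holds iff `k ≥ 1` and `F̄^[k] (x,1) ∈ R`. -/
def hitsR (R : Set (ℝ × ℝ)) (x : ℝ) (k : ℕ) : Prop := 1 ≤ k ∧ fareyNE^[k] (x, 1) ∈ R

/-- `Nidx R x n = N_n`: `N_0 = 0` and, for `n ≥ 1`, the `n`-th smallest `k ≥ 1`
with `F̄^[k] (x,1) ∈ R`. -/
def Nidx (R : Set (ℝ × ℝ)) (x : ℝ) : ℕ → ℕ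
  | 0 => 0
  | n + 1 => Nat.nth (hitsR R x) n

/-- `h(x,y) = (1−y)/(x + y − xy)`. -/
def hIto (p : ℝ × ℝ) : ℝ := (1 - p.2) / (p.1 + p.2 - p.1 * p.2)

/-- `Θ_n(x) = s_n(x)·|s_n(x)·x − u_n(x)|`, the approximation coefficient of the
`n`-th Farey convergent `u_n(x)/s_n(x)`. -/
def ThetaF (x : ℝ) (n : ℕ) : ℝ := (sF x n : ℝ) * |(sF x n : ℝ) * x - (uF x n : ℝ)|

/-- `Θ_n^R(x) = s_n^R·|s_n^R·x − u_n^R|` where `u_n^R = u_{N_n}(x)`, `s_n^R = s_{N_n}(x)`. -/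
def ThetaR (R : Set (ℝ × ℝ)) (x : ℝ) (n : ℕ) : ℝ := ThetaF x (Nidx R x n)

/-- The Gauss map. -/
def gaussMap (x : ℝ) : ℝ := Int.fract (1 / x)

/-- `pquot x n` is the RCF partial quotient `a_{n+1}(x)`. -/
def pquot (x : ℝ) (n : ℕ) : ℤ := ⌊1 / (gaussMap^[n] x)⌋

/-- `pnum x (j+1)` is the RCF numerator `p_j(x)`; `pnum x 0 = p_{-1} = 1`. -/
def pnum (x : ℝ) : ℕ → ℤ
  | 0 => 1
  | 1 => 0
  | n + 2 => pquot x n * pnum x (n + 1) + pnum x n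

/-- `qden x (j+1)` is the RCF denominator `q_j(x)`; `qden x 0 = q_{-1} = 0`. -/
def qden (x : ℝ) : ℕ → ℤ
  | 0 => 0
  | 1 => 1
  | n + 2 => pquot x n * qden x (n + 1) + qden x n

/-- The approximation coefficient `Θ(x, p/q) = q·|q·x − p|`. -/
def Theta (x : ℝ) (p q : ℤ) : ℝ := (q : ℝ) * |(q : ℝ) * x - (p : ℝ)|

/-- `medTheta x l j = Θ(x, (l·p_j + p_{j−1})/(l·q_j + q_{j−1}))`. -/
def medTheta (x : ℝ) (l : ℤ) (j : ℕ) : ℝ :=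
  Theta x (l * pnum x (j + 1) + pnum x j) (l * qden x (j + 1) + qden x j)

end

/-- `t_n(x)`: top-right entry of `M_n(x)`. -/
noncomputable def tF (x : ℝ) (n : ℕ) : ℤ := Mmat x n 0 1

/-- `r_n(x)`: bottom-right entry of `M_n(x)`. -/
noncomputable def rF (x : ℝ) (n : ℕ) : ℤ := Mmat x n 1 1

lemma entries_succ_of_le {x : ℝ} {n : ℕ} (h : fareyMap^[n] x ≤ 1 / 2) :
    uF x (n + 1) = uF x n + tF x n ∧ tF x (n + 1) = tF x n ∧
      sF x (n + 1) = sF x n + rF x n ∧ rF x (n + 1) = rF x n := by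
  have he : eps x n = 0 := if_pos h
  simp [uF, tF, sF, rF, Mmat, he, Amat, Matrix.mul_apply, Fin.sum_univ_two]

lemma entries_succ_of_lt {x : ℝ} {n : ℕ} (h : 1 / 2 < fareyMap^[n] x) :
    uF x (n + 1) = tF x n ∧ tF x (n + 1) = uF x n + tF x n ∧
      sF x (n + 1) = rF x n ∧ rF x (n + 1) = sF x n + rF x n := by
  have he : eps x n = 1 := if_neg (not_le.2 h)
  simp [uF, tF, sF, rF, Mmat, he, Amat, Matrix.mul_apply, Fin.sum_univ_two]

lemma entries_zero (x : ℝ) : uF x 0 = 1 ∧ tF x 0 = 0 ∧ sF x 0 = 0 ∧ rF x 0 = 1 := by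
  simp [uF, tF, sF, rF, Mmat]

lemma sF_nonneg_and_rF_pos (x : ℝ) (n : ℕ) : 0 ≤ sF x n ∧ 1 ≤ rF x n := by
  induction n with
  | zero => simp [entries_zero]
  | succ n ih =>
    rcases le_or_gt (fareyMap^[n] x) (1 / 2) with h | h
    · obtain ⟨-, -, h3, h4⟩ := entries_succ_of_le h
      omega
    · obtain ⟨-, -, h3, h4⟩ := entries_succ_of_lt h
      omega

lemma sF_succ_pos (x : ℝ) (n : ℕ) : 1 ≤ sF x (n + 1) := by
  have := sF_nonneg_and_rF_pos x n
  rcases le_or_gt (fareyMap^[n] x) (1 / 2) with h | h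
  · obtain ⟨-, -, h3, h4⟩ := entries_succ_of_le h
    omega
  · obtain ⟨-, -, h3, h4⟩ := entries_succ_of_lt h
    omega

lemma rF_le_succ (x : ℝ) (n : ℕ) : rF x n ≤ rF x (n + 1) := by
  have := sF_nonneg_and_rF_pos x n
  rcases le_or_gt (fareyMap^[n] x) (1 / 2) with h | h
  · obtain ⟨-, -, h3, h4⟩ := entries_succ_of_le h
    omega
  · obtain ⟨-, -, h3, h4⟩ := entries_succ_of_lt h
    omega

lemma det_entries_sq (x : ℝ) (n : ℕ) :
    (uF x n * rF x n - tF x n * sF x n) ^ 2 = 1 := by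
  induction n with
  | zero => simp [entries_zero]
  | succ n ih =>
    rcases le_or_gt (fareyMap^[n] x) (1 / 2) with h | h
    · obtain ⟨h1, h2, h3, h4⟩ := entries_succ_of_le h
      rw [h1, h2, h3, h4, ← ih]
      ring
    · obtain ⟨h1, h2, h3, h4⟩ := entries_succ_of_lt h
      rw [h1, h2, h3, h4, ← ih]
      ring

lemma fareyMap_mem {x : ℝ} (hx : x ∈ Set.Ioo (0 : ℝ) 1) (hirr : Irrational x) :
    fareyMap x ∈ Set.Ioo (0 : ℝ) 1 ∧ Irrational (fareyMap x) := by
  obtain ⟨h0, h1⟩ := hx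
  have h2 : x ≠ 1 / 2 := fun h => hirr ⟨1 / 2, by rw [h]; push_cast; ring⟩
  unfold fareyMap
  split_ifs with h
  · have h3 : x < 1 / 2 := lt_of_le_of_ne h h2
    have h4 : 0 < 1 - x := by linarith
    refine ⟨⟨by positivity, by rw [div_lt_one h4]; linarith⟩, ?_⟩
    rintro ⟨q, hq⟩
    refine hirr ⟨q / (1 + q), ?_⟩
    push_cast
    rw [hq]
    field_simp
    ring
  · push Not at h
    have h4 : 0 < 1 - x := by linarith
    refine ⟨⟨by positivity, by rw [div_lt_one h0]; linarith⟩, ?_⟩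
    rintro ⟨q, hq⟩
    refine hirr ⟨1 / (1 + q), ?_⟩
    push_cast
    rw [hq]
    field_simp
    ring

lemma fareyMap_iterate_mem {x : ℝ} (hx : x ∈ Set.Ioo (0 : ℝ) 1) (hirr : Irrational x) (n : ℕ) :
    fareyMap^[n] x ∈ Set.Ioo (0 : ℝ) 1 ∧ Irrational (fareyMap^[n] x) := by
  induction n with
  | zero => exact ⟨hx, hirr⟩
  | succ n ih =>
    rw [Function.iterate_succ_apply']
    exact fareyMap_mem ih.1 ih.2

lemma exists_half_lt_iterate {x : ℝ} (hx : x ∈ Set.Ioo (0 : ℝ) 1) (hirr : Irrational x) (N : ℕ) :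
    ∃ n ≥ N, 1 / 2 < fareyMap^[n] x := by
  by_contra! hcon
  have key : ∀ k : ℕ, 1 / fareyMap^[N + k] x = 1 / fareyMap^[N] x - k := by
    intro k
    induction k with
    | zero => simp
    | succ k ih =>
      have h := hcon (N + k) (by omega)
      obtain ⟨⟨h0, h1⟩, -⟩ := fareyMap_iterate_mem hx hirr (N + k)
      rw [← add_assoc, Function.iterate_succ_apply']
      have : 1 / fareyMap (fareyMap^[N + k] x) = 1 / fareyMap^[N + k] x - 1 := by
        rw [fareyMap, if_pos h]
        have : 1 - fareyMap^[N + k] x ≠ 0 := by linarith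
        field_simp
      rw [this, ih]
      push_cast
      ring
  obtain ⟨k, hk⟩ := exists_nat_gt (1 / fareyMap^[N] x)
  have h1 := key k
  have h2 : 0 < 1 / fareyMap^[N + k] x :=
    one_div_pos.2 (fareyMap_iterate_mem hx hirr (N + k)).1.1
  linarith

lemma tendsto_rF {x : ℝ} (hx : x ∈ Set.Ioo (0 : ℝ) 1) (hirr : Irrational x) :
    Tendsto (fun n => (rF x n : ℝ)) atTop atTop := by
  have hmono : Monotone (rF x) := monotone_nat_of_le_succ (rF_le_succ x)
  refine tendsto_intCast_atTop_atTop.comp (tendsto_atTop_atTop_of_monotone hmono fun b => ?_)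
  have key : ∀ k : ℕ, ∃ n, (k : ℤ) ≤ rF x n := by
    intro k
    induction k with
    | zero => exact ⟨0, by simp [entries_zero]⟩
    | succ k ih =>
      obtain ⟨n, hn⟩ := ih
      obtain ⟨m, hm, hm'⟩ := exists_half_lt_iterate hx hirr (n + 1)
      refine ⟨m + 1, ?_⟩
      obtain ⟨m, rfl⟩ : ∃ j, m = j + 1 := ⟨m - 1, by omega⟩
      have h1 := (entries_succ_of_lt hm').2.2.2
      have h2 := sF_succ_pos x m
      have h3 : rF x n ≤ rF x (m + 1) := hmono (by omega)
      push_cast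
      omega
  obtain ⟨n, hn⟩ := key b.toNat
  exact ⟨n, le_trans (Int.self_le_toNat b) hn⟩

/-- The inverse branch of `F^[n]` on the Farey cylinder of rank `n` containing `x`. -/
noncomputable def fareyBranch (x : ℝ) (n : ℕ) (y : ℝ) : ℝ :=
  (uF x n * y + tF x n) / (sF x n * y + rF x n)

lemma denom_pos (x : ℝ) (n : ℕ) {y : ℝ} (hy : 0 ≤ y) : 0 < (sF x n : ℝ) * y + rF x n := by
  obtain ⟨h1, h2⟩ := sF_nonneg_and_rF_pos x n
  have h1' : (0 : ℝ) ≤ sF x n := by exact_mod_cast h1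
  have h2' : (1 : ℝ) ≤ rF x n := by exact_mod_cast h2
  nlinarith [mul_nonneg h1' hy]

lemma fareyBranch_succ_of_le {x : ℝ} {n : ℕ} (h : fareyMap^[n] x ≤ 1 / 2) {y : ℝ} (hy : 0 < y) :
    fareyBranch x (n + 1) y = fareyBranch x n (y / (1 + y)) := by
  obtain ⟨h1, h2, h3, h4⟩ := entries_succ_of_le h
  have hd := denom_pos x (n + 1) hy.le
  have hd' := denom_pos x n (y := y / (1 + y)) (by positivity)
  unfold fareyBranch
  rw [div_eq_div_iff hd.ne' hd'.ne', h1, h2, h3, h4]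
  push_cast
  field_simp
  ring

lemma fareyBranch_succ_of_lt {x : ℝ} {n : ℕ} (h : 1 / 2 < fareyMap^[n] x) {y : ℝ} (hy : 0 < y) :
    fareyBranch x (n + 1) y = fareyBranch x n (1 / (1 + y)) := by
  obtain ⟨h1, h2, h3, h4⟩ := entries_succ_of_lt h
  have hd := denom_pos x (n + 1) hy.le
  have hd' := denom_pos x n (y := 1 / (1 + y)) (by positivity)
  unfold fareyBranch
  rw [div_eq_div_iff hd.ne' hd'.ne', h1, h2, h3, h4]
  push_cast
  field_simp
  ring

lemma iterate_fareyBranch (x : ℝ) (n : ℕ) {y : ℝ} (hy : y ∈ Set.Ioo (0 : ℝ) 1) :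
    fareyMap^[n] (fareyBranch x n y) = y := by
  induction n generalizing y with
  | zero => simp [fareyBranch, entries_zero]
  | succ n ih =>
    obtain ⟨h0, h1⟩ := hy
    rw [Function.iterate_succ_apply']
    rcases le_or_gt (fareyMap^[n] x) (1 / 2) with h | h
    · rw [fareyBranch_succ_of_le h h0,
        ih ⟨by positivity, by rw [div_lt_one (by positivity)]; linarith⟩, fareyMap, if_pos]
      · field_simp
        ring
      · rw [div_le_div_iff₀ (by positivity) (by positivity)]
        linarith
    · rw [fareyBranch_succ_of_lt h h0,
        ih ⟨by positivity, by rw [div_lt_one (by positivity)]; linarith⟩, fareyMap, if_neg]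
      · field_simp
        ring
      · rw [not_le, div_lt_div_iff₀ (by positivity) (by positivity)]
        linarith

lemma fareyBranch_iterate {x : ℝ} (hx : x ∈ Set.Ioo (0 : ℝ) 1) (hirr : Irrational x) (n : ℕ) :
    fareyBranch x n (fareyMap^[n] x) = x := by
  induction n with
  | zero => simp [fareyBranch, entries_zero]
  | succ n ih =>
    have hpos := (fareyMap_iterate_mem hx hirr (n + 1)).1.1
    obtain ⟨h0, h1⟩ := (fareyMap_iterate_mem hx hirr n).1
    rcases le_or_gt (fareyMap^[n] x) (1 / 2) with h | h
    · rw [fareyBranch_succ_of_le h hpos, Function.iterate_succ_apply', fareyMap, if_pos h]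
      convert ih using 2
      have : 1 - fareyMap^[n] x ≠ 0 := by linarith
      field_simp
      ring
    · rw [fareyBranch_succ_of_lt h hpos, Function.iterate_succ_apply', fareyMap,
        if_neg (not_le.2 h)]
      convert ih using 2
      field_simp
      ring

lemma hasDerivAt_fareyBranch (x : ℝ) (n : ℕ) {y : ℝ} (hy : 0 ≤ y) :
    HasDerivAt (fareyBranch x n)
      ((uF x n * rF x n - tF x n * sF x n : ℝ) / (sF x n * y + rF x n) ^ 2) y := by
  have h1 : HasDerivAt (fun y : ℝ => (uF x n * y + tF x n : ℝ)) (uF x n) y := by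
    simpa using ((hasDerivAt_id y).const_mul (uF x n : ℝ)).add_const (tF x n : ℝ)
  have h2 : HasDerivAt (fun y : ℝ => (sF x n * y + rF x n : ℝ)) (sF x n) y := by
    simpa using ((hasDerivAt_id y).const_mul (sF x n : ℝ)).add_const (rF x n : ℝ)
  exact (h1.div h2 (denom_pos x n hy).ne').congr_deriv (by ring)

lemma abs_det_entries (x : ℝ) (n : ℕ) : |(uF x n * rF x n - tF x n * sF x n : ℝ)| = 1 := by
  have h := det_entries_sq x n
  have h' : (uF x n * rF x n - tF x n * sF x n : ℝ) ^ 2 = 1 := by exact_mod_cast h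
  rcases sq_eq_one_iff.1 h' with h | h <;> simp [h]

/-- The center of the Farey cylinder of rank `n` containing `x`. -/
noncomputable def cylCenter (x : ℝ) (n : ℕ) : ℝ :=
  (tF x n / rF x n + (uF x n + tF x n) / (sF x n + rF x n)) / 2

/-- Half the length of the Farey cylinder of rank `n` containing `x`. -/
noncomputable def cylRadius (x : ℝ) (n : ℕ) : ℝ := 1 / (2 * (rF x n * (sF x n + rF x n)))

lemma fareyBranch_mem_cyl (x : ℝ) (n : ℕ) {y : ℝ} (hy : y ∈ Set.Icc (0 : ℝ) 1) :
    fareyBranch x n y ∈ Metric.closedBall (cylCenter x n) (cylRadius x n) := by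
  obtain ⟨h1, h2⟩ := sF_nonneg_and_rF_pos x n
  have hd := denom_pos x n hy.1
  have hdet := abs_det_entries x n
  rw [Metric.mem_closedBall, Real.dist_eq]
  unfold fareyBranch cylCenter cylRadius
  generalize (uF x n : ℝ) = u at *
  generalize (tF x n : ℝ) = t at *
  have hs : (0 : ℝ) ≤ sF x n := by exact_mod_cast h1
  have hr : (1 : ℝ) ≤ rF x n := by exact_mod_cast h2
  generalize (sF x n : ℝ) = s at *
  generalize (rF x n : ℝ) = r at *
  have hr0 : 0 < r := by linarith
  have hsr : 0 < s + r := by linarith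
  have : (u * y + t) / (s * y + r) - (t / r + (u + t) / (s + r)) / 2
      = (u * r - t * s) * ((1 / r) * (y / (s * y + r) - 1 / (2 * (s + r)))) := by
    generalize hD : s * y + r = D at hd
    field_simp
    rw [← hD]
    ring
  rw [this, abs_mul, hdet, one_mul, abs_mul, abs_of_pos (by positivity : 0 < 1 / r)]
  have h3 : |y / (s * y + r) - 1 / (2 * (s + r))| ≤ 1 / (2 * (s + r)) := by
    have h4 : 0 ≤ y / (s * y + r) := div_nonneg hy.1 hd.le
    have h5 : y / (s * y + r) ≤ 1 / (s + r) := by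
      rw [div_le_div_iff₀ hd hsr]
      nlinarith [hy.2]
    have h6 : 1 / (s + r) = 1 / (2 * (s + r)) + 1 / (2 * (s + r)) := by
      field_simp
      ring
    rw [abs_le]
    constructor <;> linarith
  calc 1 / r * |y / (s * y + r) - 1 / (2 * (s + r))| ≤ 1 / r * (1 / (2 * (s + r))) := by gcongr
    _ = 1 / (2 * (r * (s + r))) := by field_simp

lemma volume_image_fareyBranch_ge (x : ℝ) (n : ℕ) {U : Set ℝ} (hU : MeasurableSet U)
    (hU1 : U ⊆ Set.Ioo 0 1) :
    MeasurableSet (fareyBranch x n '' U) ∧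
    ENNReal.ofReal (1 / (sF x n + rF x n : ℝ) ^ 2) * volume U ≤ volume (fareyBranch x n '' U) := by
  have hd : ∀ y ∈ U, HasDerivWithinAt (fareyBranch x n)
      ((uF x n * rF x n - tF x n * sF x n : ℝ) / (sF x n * y + rF x n) ^ 2) U y :=
    fun y hy => (hasDerivAt_fareyBranch x n (hU1 hy).1.le).hasDerivWithinAt
  have hinj : Set.InjOn (fareyBranch x n) U := by
    intro a ha b hb hab
    rw [← iterate_fareyBranch x n (hU1 ha), hab, iterate_fareyBranch x n (hU1 hb)]
  refine ⟨measurable_image_of_fderivWithin hU (fun y hy => (hd y hy).hasFDerivWithinAt) hinj, ?_⟩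
  have h := lintegral_image_eq_lintegral_abs_deriv_mul hU hd hinj 1
  simp only [Pi.one_apply, lintegral_const, Measure.restrict_apply MeasurableSet.univ,
    Set.univ_inter, one_mul, mul_one] at h
  rw [h, ← setLIntegral_const]
  refine setLIntegral_mono' hU fun y hy => ENNReal.ofReal_le_ofReal ?_
  have hden := denom_pos x n (hU1 hy).1.le
  rw [abs_div, abs_det_entries, abs_of_pos (by positivity)]
  have hs : (0 : ℝ) ≤ sF x n := by exact_mod_cast (sF_nonneg_and_rF_pos x n).1
  have := (hU1 hy).2
  gcongr
  nlinarith

lemma ae_exists_iterate_mem {U : Set ℝ} (hU : MeasurableSet U) (hU1 : U ⊆ Set.Ioo 0 1)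
    (hpos : volume U ≠ 0) (N : ℕ) :
    ∀ᵐ x ∂(volume : Measure ℝ), x ∈ Set.Ioo (0 : ℝ) 1 → Irrational x →
      ∃ n ≥ N, fareyMap^[n] x ∈ U := by
  set C : Set ℝ := {x | x ∈ Set.Ioo (0 : ℝ) 1 ∧ Irrational x ∧ ∀ n ≥ N, fareyMap^[n] x ∉ U} with hC
  have hCx : ∀ x ∈ C, ¬ (∀ {ι : Type} {l : Filter ι} (w : ι → ℝ) (δ : ι → ℝ)
      (_ : Tendsto δ l (𝓝[>] 0)) (_ : ∀ᶠ j in l, x ∈ Metric.closedBall (w j) (1 * δ j)),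
      Tendsto (fun j => volume (C ∩ Metric.closedBall (w j) (δ j)) /
        volume (Metric.closedBall (w j) (δ j))) l (𝓝 1)) := by
    rintro x ⟨hx, hirr, hxU⟩ hden
    let l : Filter ℕ := atTop ⊓ 𝓟 {n | sF x n ≤ rF x n}
    have hl : l.NeBot := by
      rw [← frequently_mem_iff_neBot, frequently_atTop]
      intro a
      obtain ⟨n, hn, hn'⟩ := exists_half_lt_iterate hx hirr a
      refine ⟨n + 1, by omega, ?_⟩
      have h1 := entries_succ_of_lt hn'
      have h2 := sF_nonneg_and_rF_pos x n
      change sF x (n + 1) ≤ rF x (n + 1)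
      omega
    have hrad : ∀ n, 0 < cylRadius x n := by
      intro n
      obtain ⟨h1, h2⟩ := sF_nonneg_and_rF_pos x n
      have hs : (0 : ℝ) ≤ sF x n := by exact_mod_cast h1
      have hr : (1 : ℝ) ≤ rF x n := by exact_mod_cast h2
      unfold cylRadius
      positivity
    have hδ : Tendsto (cylRadius x) l (𝓝[>] 0) := by
      refine tendsto_nhdsWithin_iff.2 ⟨?_, .of_forall hrad⟩
      have h1 : Tendsto (cylRadius x) atTop (𝓝 0) := by
        refine squeeze_zero (fun n => (hrad n).le) (fun n => ?_)
          (tendsto_inv_atTop_zero.comp (tendsto_rF hx hirr))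
        obtain ⟨h1, h2⟩ := sF_nonneg_and_rF_pos x n
        have hs : (0 : ℝ) ≤ sF x n := by exact_mod_cast h1
        have hr : (1 : ℝ) ≤ rF x n := by exact_mod_cast h2
        simp only [Function.comp_apply, cylRadius]
        rw [← one_div]
        gcongr
        nlinarith
      exact h1.mono_left inf_le_left
    have hmem : ∀ᶠ n in l, x ∈ Metric.closedBall (cylCenter x n) (1 * cylRadius x n) := by
      refine .of_forall fun n => ?_
      rw [one_mul]
      have h := fareyBranch_mem_cyl x n
        (Set.Ioo_subset_Icc_self (fareyMap_iterate_mem hx hirr n).1)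
      rwa [fareyBranch_iterate hx hirr n] at h
    have hlim := hden (cylCenter x) (cylRadius x) hδ hmem
    have hbound : ∀ᶠ n in l, volume (C ∩ Metric.closedBall (cylCenter x n) (cylRadius x n)) /
        volume (Metric.closedBall (cylCenter x n) (cylRadius x n)) ≤ 1 - volume U / 2 := by
      have hN : ∀ᶠ n in l, N ≤ n := (eventually_ge_atTop N).filter_mono inf_le_left
      have hsr : ∀ᶠ n in l, sF x n ≤ rF x n := mem_inf_of_right (mem_principal_self _)
      filter_upwards [hN, hsr] with n hn hsr
      obtain ⟨hmeas, hvol⟩ := volume_image_fareyBranch_ge x n hU hU1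
      set I := Metric.closedBall (cylCenter x n) (cylRadius x n) with hI
      have hsub : fareyBranch x n '' U ⊆ I := by
        rintro _ ⟨y, hy, rfl⟩
        exact fareyBranch_mem_cyl x n (Set.Ioo_subset_Icc_self (hU1 hy))
      have hCI : C ∩ I ⊆ I \ fareyBranch x n '' U := by
        rintro z ⟨hzC, hzI⟩
        refine ⟨hzI, ?_⟩
        rintro ⟨y, hy, rfl⟩
        refine hzC.2.2 n hn ?_
        rwa [iterate_fareyBranch x n (hU1 hy)]
      have hIvol : volume I = ENNReal.ofReal (2 * cylRadius x n) := Real.volume_closedBall _ _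
      have hI0 : volume I ≠ 0 := by
        rw [hIvol]
        simpa using hrad n
      have hItop : volume I ≠ ⊤ := by
        rw [hIvol]
        exact ENNReal.ofReal_ne_top
      have h1 : volume I * (volume U / 2) ≤ volume (fareyBranch x n '' U) := by
        refine le_trans ?_ hvol
        obtain ⟨h1, h2⟩ := sF_nonneg_and_rF_pos x n
        have hs : (0 : ℝ) ≤ sF x n := by exact_mod_cast h1
        have hr : (1 : ℝ) ≤ rF x n := by exact_mod_cast h2
        have hsr' : (sF x n : ℝ) ≤ rF x n := by exact_mod_cast hsr
        have h2 : (2 : ENNReal)⁻¹ = ENNReal.ofReal (1 / 2) := by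
          rw [one_div, ENNReal.ofReal_inv_of_pos (by norm_num)]
          simp
        rw [div_eq_mul_inv, mul_comm (volume U), ← mul_assoc, hIvol, h2,
          ← ENNReal.ofReal_mul (by linarith [hrad n])]
        gcongr
        unfold cylRadius
        generalize (sF x n : ℝ) = s at *
        generalize (rF x n : ℝ) = r at *
        have : 2 * (1 / (2 * (r * (s + r)))) * (1 / 2) = 1 / (2 * (r * (s + r))) := by
          field_simp
        rw [this]
        have hr0 : 0 < r := by linarith
        apply one_div_le_one_div_of_le (by positivity)
        nlinarith
      have h2 : volume (C ∩ I) ≤ volume I - volume I * (volume U / 2) := by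
        calc volume (C ∩ I) ≤ volume (I \ fareyBranch x n '' U) := measure_mono hCI
          _ = volume I - volume (fareyBranch x n '' U) :=
            measure_sdiff hsub hmeas.nullMeasurableSet
              ((measure_mono hsub).trans_lt hItop.lt_top).ne
          _ ≤ _ := tsub_le_tsub_left h1 _
      calc volume (C ∩ I) / volume I
          ≤ (volume I - volume I * (volume U / 2)) / volume I := by gcongr
        _ = (volume I * (1 - volume U / 2)) / volume I := by
            rw [ENNReal.mul_sub (fun _ _ => hItop), mul_one]
        _ = 1 - volume U / 2 := by
            rw [mul_comm, ENNReal.mul_div_cancel_right hI0 hItop]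
    have h1 : (1 : ENNReal) ≤ 1 - volume U / 2 := le_of_tendsto hlim hbound
    have h2 : (1 : ENNReal) - volume U / 2 < 1 :=
      ENNReal.sub_lt_self (by simp) (by simp) (by simpa using hpos)
    exact absurd h1 (not_le.2 h2)
  have hnull : volume C = 0 := by
    have h := IsUnifLocDoublingMeasure.ae_tendsto_measure_inter_div (volume : Measure ℝ) C 1
    have h' : ∀ᵐ x ∂(volume.restrict C), x ∉ C := by
      filter_upwards [h] with x hx hxC
      exact hCx x hxC fun w δ h1 h2 => hx w δ h1 h2
    rw [ae_iff] at h'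
    simp only [not_not] at h'
    have h'' : volume.restrict C C = 0 := h'
    rwa [Measure.restrict_apply_self] at h''
  filter_upwards [measure_eq_zero_iff_ae_notMem.1 hnull] with x hx h0 h1
  by_contra! hcon
  exact hx ⟨h0, h1, hcon⟩

lemma integrable_comp_of_lintegral_comp_le {α : Type*} [MeasurableSpace α] {μ : Measure α}
    {T : α → α} (hT : Measurable T)
    (hsub : ∀ g : α → ENNReal, ∫⁻ p, g (T p) ∂μ ≤ ∫⁻ p, g p ∂μ) {f : α → ℝ} (hf : Measurable f)
    (h_int : Integrable f μ) : Integrable (fun p => f (T p)) μ :=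
  ⟨(hf.comp hT).aestronglyMeasurable, (hsub fun p => ‖f p‖ₑ).trans_lt h_int.2⟩

lemma integral_comp_le_of_lintegral_comp_le {α : Type*} [MeasurableSpace α] {μ : Measure α}
    {T : α → α} (hT : Measurable T)
    (hsub : ∀ g : α → ENNReal, ∫⁻ p, g (T p) ∂μ ≤ ∫⁻ p, g p ∂μ) {f : α → ℝ} (hf : Measurable f)
    (h_int : Integrable f μ) (h0 : ∀ p, 0 ≤ f p) : ∫ p, f (T p) ∂μ ≤ ∫ p, f p ∂μ := by
  rw [integral_eq_lintegral_of_nonneg_ae (.of_forall fun p => h0 (T p))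
      (hf.comp hT).aestronglyMeasurable,
    integral_eq_lintegral_of_nonneg_ae (.of_forall h0) hf.aestronglyMeasurable]
  refine ENNReal.toReal_mono ?_ (hsub fun p => ENNReal.ofReal (f p))
  exact (hasFiniteIntegral_iff_ofReal (.of_forall h0)).1 h_int.2 |>.ne

/-- The running maximum of the Birkhoff sums of order at most `n` of `h`. -/
noncomputable def birkhoffMax {α : Type*} (T : α → α) (h : α → ℝ) : ℕ → α → ℝ
  | 0 => fun _ => 0
  | n + 1 => fun p => max 0 (h p + birkhoffMax T h n (T p))

lemma birkhoffMax_le_succ {α : Type*} (T : α → α) (h : α → ℝ) (n : ℕ) (p : α) :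
    birkhoffMax T h n p ≤ birkhoffMax T h (n + 1) p := by
  induction n generalizing p with
  | zero => exact le_max_left _ _
  | succ n ih =>
    simp only [birkhoffMax] at ih ⊢
    gcongr
    exact ih (T p)

lemma birkhoffMax_nonneg {α : Type*} (T : α → α) (h : α → ℝ) (n : ℕ) (p : α) :
    0 ≤ birkhoffMax T h n p := by
  cases n with
  | zero => exact le_rfl
  | succ n => exact le_max_left _ _

lemma birkhoffSum_le_birkhoffMax {α : Type*} (T : α → α) (h : α → ℝ) (n : ℕ) (p : α) :
    birkhoffSum T h n p ≤ birkhoffMax T h n p := by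
  induction n generalizing p with
  | zero => simp [birkhoffMax]
  | succ n ih =>
    rw [birkhoffSum_succ']
    exact (add_le_add_right (ih (T p)) _).trans (le_max_right _ _)

lemma birkhoffMax_le_indicator_add {α : Type*} (T : α → α) (h : α → ℝ) (n : ℕ) (p : α) :
    birkhoffMax T h n p ≤
      {q | 0 < birkhoffMax T h n q}.indicator h p + birkhoffMax T h n (T p) := by
  by_cases hp : 0 < birkhoffMax T h n p
  · rw [Set.indicator_of_mem (show p ∈ {q | 0 < birkhoffMax T h n q} from hp)]
    cases n with
    | zero => exact absurd hp (lt_irrefl _)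
    | succ n =>
      have h1 : birkhoffMax T h (n + 1) p = h p + birkhoffMax T h n (T p) := by
        simp only [birkhoffMax] at hp ⊢
        rcases max_choice 0 (h p + birkhoffMax T h n (T p)) with h2 | h2
        · exact absurd (h2 ▸ hp) (lt_irrefl _)
        · exact h2
      rw [h1]
      gcongr
      exact birkhoffMax_le_succ T h n (T p)
  · rw [Set.indicator_of_notMem (show p ∉ {q | 0 < birkhoffMax T h n q} from hp), zero_add]
    exact (not_lt.1 hp).trans (birkhoffMax_nonneg T h n _)

/-- A form of the **maximal ergodic theorem**, for a transformation that does not increase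
a possibly infinite measure. -/
theorem integral_nonneg_of_ae_exists_birkhoffSum_pos {α : Type*} [MeasurableSpace α]
    {μ : Measure α} {T : α → α} (hT : Measurable T)
    (hsub : ∀ g : α → ENNReal, ∫⁻ p, g (T p) ∂μ ≤ ∫⁻ p, g p ∂μ) {h : α → ℝ} (hh : Measurable h)
    (h_int : Integrable h μ) (hpos : ∀ᵐ p ∂μ, ∃ n, 0 < birkhoffSum T h n p) :
    0 ≤ ∫ p, h p ∂μ := by
  have hM : ∀ n, Measurable (birkhoffMax T h n) := by
    intro n
    induction n with
    | zero => exact measurable_const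
    | succ n ih => exact measurable_const.max (hh.add (ih.comp hT))
  have hMint : ∀ n, Integrable (birkhoffMax T h n) μ := by
    intro n
    induction n with
    | zero => exact integrable_zero _ _ _
    | succ n ih =>
      exact (integrable_zero _ _ _).sup
        (h_int.add (integrable_comp_of_lintegral_comp_le hT hsub (hM n) ih))
  let E : ℕ → Set α := fun n => {q | 0 < birkhoffMax T h n q}
  have hE : ∀ n, MeasurableSet (E n) := fun n => measurableSet_lt measurable_const (hM n)
  have hEint : ∀ n, 0 ≤ ∫ p in E n, h p ∂μ := by
    intro n
    rw [← integral_indicator (hE n)]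
    have h1 : ∫ p, birkhoffMax T h n p ∂μ ≤
        ∫ p, ((E n).indicator h p + birkhoffMax T h n (T p)) ∂μ :=
      integral_mono (hMint n) ((h_int.indicator (hE n)).add
        (integrable_comp_of_lintegral_comp_le hT hsub (hM n) (hMint n)))
        (birkhoffMax_le_indicator_add T h n)
    rw [integral_add (h_int.indicator (hE n))
      (integrable_comp_of_lintegral_comp_le hT hsub (hM n) (hMint n))] at h1
    have h2 := integral_comp_le_of_lintegral_comp_le hT hsub (hM n) (hMint n)
      (birkhoffMax_nonneg T h n)
    linarith
  have hmono : Monotone E := monotone_nat_of_le_succ fun n p hp =>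
    lt_of_lt_of_le hp (birkhoffMax_le_succ T h n p)
  have hlim := tendsto_setIntegral_of_monotone hE hmono h_int.integrableOn
  have hU : ∫ p in ⋃ n, E n, h p ∂μ = ∫ p, h p ∂μ := by
    rw [setIntegral_congr_set (t := Set.univ), setIntegral_univ]
    refine eventuallyEq_univ.2 ?_
    filter_upwards [hpos] with p ⟨n, hn⟩
    exact Set.mem_iUnion.2 ⟨n, lt_of_lt_of_le hn (birkhoffSum_le_birkhoffMax T h n p)⟩
  rw [← hU]
  exact ge_of_tendsto' hlim hEint

/-- The natural extension `F̄` in the coordinates `(x, t)` with `t = h(x, y)`, in which its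
invariant measure is Lebesgue measure on `thetaDomain`. -/
noncomputable def fareySkew (p : ℝ × ℝ) : ℝ × ℝ :=
  if p.1 ≤ 1 / 2 then (p.1 / (1 - p.1), (1 - p.1) + (1 - p.1) ^ 2 * p.2)
  else ((1 - p.1) / p.1, p.1 - p.1 ^ 2 * p.2)

/-- The region `0 < x < 1`, `0 < t < 1 / x`. -/
def thetaDomain : Set (ℝ × ℝ) :=
  regionBetween (fun _ => (0 : ℝ)) (fun x => 1 / x) (Set.Ioo 0 1)

lemma measurableSet_thetaDomain : MeasurableSet thetaDomain :=
  measurableSet_regionBetween measurable_const (by fun_prop) measurableSet_Ioo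

lemma measurable_fareySkew : Measurable fareySkew := by
  refine Measurable.ite (measurableSet_le measurable_fst measurable_const) ?_ ?_ <;> fun_prop

lemma hasFDerivAt_fareySkew_left {p : ℝ × ℝ} (hp : 1 - p.1 ≠ 0) :
    HasFDerivAt (fun p : ℝ × ℝ => (p.1 / (1 - p.1), (1 - p.1) + (1 - p.1) ^ 2 * p.2))
      (Matrix.toLin (.finTwoProd ℝ) (.finTwoProd ℝ)
        !![1 / (1 - p.1) ^ 2, 0;
          -1 - 2 * (1 - p.1) * p.2, (1 - p.1) ^ 2]).toContinuousLinearMap p := by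
  have h1 : HasFDerivAt (fun p : ℝ × ℝ => 1 - p.1) (-ContinuousLinearMap.fst ℝ ℝ ℝ) p :=
    hasFDerivAt_fst.const_sub 1
  have hfst : HasFDerivAt (Prod.fst : ℝ × ℝ → ℝ) (ContinuousLinearMap.fst ℝ ℝ ℝ) p :=
    hasFDerivAt_fst
  have h2 : HasFDerivAt (fun p : ℝ × ℝ => p.1 / (1 - p.1)) _ p :=
    ((hasDerivAt_id p.1).div ((hasDerivAt_id p.1).const_sub 1) hp).comp_hasFDerivAt p hfst
  rw [Matrix.toLin_finTwoProd_toContinuousLinearMap]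
  convert! h2.prodMk (h1.add ((h1.pow 2).mul hasFDerivAt_snd)) using 1
  ext <;> simp <;> ring

lemma hasFDerivAt_fareySkew_right {p : ℝ × ℝ} (hp : p.1 ≠ 0) :
    HasFDerivAt (fun p : ℝ × ℝ => ((1 - p.1) / p.1, p.1 - p.1 ^ 2 * p.2))
      (Matrix.toLin (.finTwoProd ℝ) (.finTwoProd ℝ)
        !![-1 / p.1 ^ 2, 0; 1 - 2 * p.1 * p.2, - p.1 ^ 2]).toContinuousLinearMap p := by
  have hfst : HasFDerivAt (Prod.fst : ℝ × ℝ → ℝ) (ContinuousLinearMap.fst ℝ ℝ ℝ) p :=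
    hasFDerivAt_fst
  have h2 : HasFDerivAt (fun p : ℝ × ℝ => (1 - p.1) / p.1) _ p :=
    (((hasDerivAt_id p.1).const_sub 1).div (hasDerivAt_id p.1) hp).comp_hasFDerivAt p hfst
  rw [Matrix.toLin_finTwoProd_toContinuousLinearMap]
  convert! h2.prodMk (hfst.sub ((hfst.pow 2).mul hasFDerivAt_snd)) using 1
  ext <;> simp <;> ring

lemma lintegral_fareySkew_le (g : ℝ × ℝ → ENNReal) :
    ∫⁻ p in thetaDomain, g (fareySkew p) ≤ ∫⁻ p in thetaDomain, g p := by
  let f₀ : ℝ × ℝ → ℝ × ℝ := fun p => (p.1 / (1 - p.1), (1 - p.1) + (1 - p.1) ^ 2 * p.2)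
  let f₁ : ℝ × ℝ → ℝ × ℝ := fun p => ((1 - p.1) / p.1, p.1 - p.1 ^ 2 * p.2)
  let H : Set (ℝ × ℝ) := {p | p.1 < 1 / 2}
  have hH : MeasurableSet H := measurableSet_lt measurable_fst measurable_const
  let L : Set (ℝ × ℝ) := {p | 1 / (1 + p.1) < p.2}
  have hL : MeasurableSet L := measurableSet_lt (by fun_prop) measurable_snd
  have hD := measurableSet_thetaDomain
  let K : Set (ℝ × ℝ) := {p | 1 / 2 < p.1}
  have hK : MeasurableSet K := measurableSet_lt measurable_const measurable_fst
  have hline : ∀ᵐ p : ℝ × ℝ, p.1 ≠ 1 / 2 :=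
    Measure.quasiMeasurePreserving_fst.ae (Measure.ae_ne volume (1 / 2 : ℝ))
  have e0 : ∫⁻ p in thetaDomain ∩ H, g (fareySkew p) = ∫⁻ p in f₀ '' (thetaDomain ∩ H), g p := by
    rw [lintegral_image_eq_lintegral_abs_det_fderiv_mul volume (hD.inter hH)
      (fun p hp => (hasFDerivAt_fareySkew_left
        (by have := hp.1.1.2; linarith)).hasFDerivWithinAt)]
    · refine setLIntegral_congr_fun (hD.inter hH) fun p hp => ?_
      have h1 : 1 - p.1 ≠ 0 := by have := hp.1.1.2; linarith
      have h2 : fareySkew p = f₀ p := if_pos (le_of_lt hp.2)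
      simp only [LinearMap.det_toContinuousLinearMap, LinearMap.det_toLin,
        Matrix.det_fin_two_of, h2]
      rw [zero_mul, sub_zero, one_div_mul_cancel (pow_ne_zero 2 h1)]
      simp [f₀]
    · rintro ⟨x, t⟩ ⟨⟨⟨h0, h1⟩, -⟩, -⟩ ⟨x', t'⟩ ⟨⟨⟨h0', h1'⟩, -⟩, -⟩ h
      simp only [Prod.mk.injEq] at h h0 h1 h0' h1' ⊢
      have h2 : 0 < 1 - x := by linarith
      have h2' : 0 < 1 - x' := by linarith
      obtain ⟨ha, hb⟩ := h
      rw [div_eq_div_iff h2.ne' h2'.ne'] at ha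
      obtain rfl : x = x' := by linarith
      refine ⟨rfl, ?_⟩
      exact mul_left_cancel₀ (pow_pos h2 2).ne' (add_left_cancel hb)
  have hHK : thetaDomain \ H =ᵐ[volume] (thetaDomain ∩ K : Set (ℝ × ℝ)) := by
    refine eventuallyEq_set.2 ?_
    filter_upwards [hline] with p hne
    constructor
    · rintro ⟨hD', hn⟩
      exact ⟨hD', lt_of_le_of_ne (not_lt.1 hn) hne.symm⟩
    · rintro ⟨hD', hk⟩
      exact ⟨hD', not_lt.2 (le_of_lt hk)⟩
  have e1 : ∫⁻ p in thetaDomain \ H, g (fareySkew p) = ∫⁻ p in f₁ '' (thetaDomain ∩ K), g p := by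
    refine (setLIntegral_congr hHK).trans ?_
    rw [lintegral_image_eq_lintegral_abs_det_fderiv_mul volume
      (hD.inter hK) (fun p hp => (hasFDerivAt_fareySkew_right hp.1.1.1.ne').hasFDerivWithinAt)]
    · refine setLIntegral_congr_fun (hD.inter hK) fun p hp => ?_
      have h1 : p.1 ≠ 0 := hp.1.1.1.ne'
      have h2 : fareySkew p = f₁ p := if_neg (not_le.2 hp.2)
      simp only [LinearMap.det_toContinuousLinearMap, LinearMap.det_toLin,
        Matrix.det_fin_two_of, h2]
      have h3 : -1 / p.1 ^ 2 * -p.1 ^ 2 - 0 * (1 - 2 * p.1 * p.2) = 1 := by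
        field_simp
        ring
      rw [h3]
      simp [f₁]
    · rintro ⟨x, t⟩ ⟨⟨⟨h0, h1⟩, -⟩, -⟩ ⟨x', t'⟩ ⟨⟨⟨h0', h1'⟩, -⟩, -⟩ h
      simp only [Prod.mk.injEq] at h h0 h1 h0' h1' ⊢
      obtain ⟨ha, hb⟩ := h
      rw [div_eq_div_iff h0.ne' h0'.ne'] at ha
      obtain rfl : x = x' := by linarith
      refine ⟨rfl, ?_⟩
      exact mul_left_cancel₀ (pow_pos h0 2).ne' (sub_right_inj.1 hb)
  have s0 : f₀ '' (thetaDomain ∩ H) ⊆ thetaDomain ∩ L := by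
    rintro _ ⟨⟨x, t⟩, ⟨⟨⟨h0, h1⟩, h2, h3⟩, h4⟩, rfl⟩
    simp only [H, Set.mem_ofPred_eq] at h0 h1 h2 h3 h4
    have h5 : 0 < 1 - x := by linarith
    rw [lt_div_iff₀ h0] at h3
    refine ⟨⟨⟨?_, ?_⟩, ?_, ?_⟩, ?_⟩ <;> simp only [f₀, L, Set.mem_ofPred_eq]
    · positivity
    · rw [div_lt_one h5]
      linarith
    · positivity
    · rw [one_div_div, lt_div_iff₀ h0]
      nlinarith [mul_pos h5 h5, mul_lt_mul_of_pos_left h3 (mul_pos h5 h5)]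
    · have : 1 / (1 + x / (1 - x)) = 1 - x := by
        field_simp
        ring
      rw [this]
      linarith [mul_pos (pow_pos h5 2) h2]
  have s1 : f₁ '' (thetaDomain ∩ K) ⊆ thetaDomain \ L := by
    rintro _ ⟨⟨x, t⟩, ⟨⟨⟨h0, h1⟩, h2, h3⟩, h4⟩, rfl⟩
    simp only [K, Set.mem_ofPred_eq] at h0 h1 h2 h3 h4
    have h5 : 0 < 1 - x := by linarith
    rw [lt_div_iff₀ h0] at h3
    have h6 : 0 < x ^ 2 * t := by positivity
    refine ⟨⟨⟨?_, ?_⟩, ?_, ?_⟩, ?_⟩ <;> simp only [f₁, L, Set.mem_ofPred_eq, not_lt]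
    · positivity
    · rw [div_lt_one h0]
      linarith
    · nlinarith [mul_lt_mul_of_pos_left h3 h0]
    · rw [one_div_div, lt_div_iff₀ h5]
      nlinarith [mul_pos h6 h5, mul_pos h0 h0]
    · have : 1 / (1 + (1 - x) / x) = x := by
        field_simp
        ring
      rw [this]
      linarith
  rw [← lintegral_inter_add_sdiff _ thetaDomain hH, e0, e1,
    ← lintegral_inter_add_sdiff g thetaDomain hL]
  exact add_le_add (lintegral_mono_set s0) (lintegral_mono_set s1)

/-- The area of the part of `thetaDomain` at height at most `z`. -/
noncomputable def capArea (z : ℝ) : ℝ := min z 1 + Real.log (max z 1)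

lemma continuous_capArea : Continuous capArea := by
  unfold capArea
  refine (continuous_id.min continuous_const).add
    ((continuous_id.max continuous_const).log fun z => ?_)
  exact (lt_of_lt_of_le one_pos (le_max_right z 1)).ne'

lemma capArea_nonneg {z : ℝ} (hz : 0 ≤ z) : 0 ≤ capArea z :=
  add_nonneg (le_min hz zero_le_one) (Real.log_nonneg (le_max_right z 1))

lemma capArea_pos {z : ℝ} (hz : 0 < z) : 0 < capArea z :=
  add_pos_of_pos_of_nonneg (lt_min hz one_pos) (Real.log_nonneg (le_max_right z 1))

lemma integrableOn_min_one_div (z : ℝ) (hz : 0 ≤ z) :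
    IntegrableOn (fun x : ℝ => min z (1 / x)) (Set.Ioo 0 1) := by
  refine Measure.integrableOn_of_bounded (M := z) (by simp) ?_ ?_
  · exact (measurable_const.min (by fun_prop)).aestronglyMeasurable
  · refine (ae_restrict_mem measurableSet_Ioo).mono fun x hx => ?_
    have : 0 ≤ min z (1 / x) := le_min hz (one_div_pos.2 hx.1).le
    rw [Real.norm_of_nonneg this]
    exact min_le_left _ _

lemma setIntegral_min_one_div {z : ℝ} (hz : 0 ≤ z) :
    ∫ x in Set.Ioo (0 : ℝ) 1, min z (1 / x) = capArea z := by
  rcases le_or_gt z 1 with h | h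
  · rw [setIntegral_congr_fun (g := fun _ => z) measurableSet_Ioo]
    · simp [capArea, h]
    · intro x hx
      exact min_eq_left (h.trans ((one_le_div hx.1).2 hx.2.le))
  · have hz0 : 0 < z := one_pos.trans h
    have hI : ∀ a b : ℝ, 0 ≤ a → a ≤ b → b ≤ 1 →
        IntervalIntegrable (fun x : ℝ => min z (1 / x)) volume a b := by
      intro a b ha hab hb
      rw [intervalIntegrable_iff_integrableOn_Ioo_of_le hab]
      exact (integrableOn_min_one_div z hz).mono_set (Set.Ioo_subset_Ioo ha hb)
    have hz1 : 1 / z ≤ 1 := (div_le_one hz0).2 h.le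
    have hz2 : 0 ≤ 1 / z := by positivity
    rw [← integral_Ioc_eq_integral_Ioo, ← intervalIntegral.integral_of_le zero_le_one,
      ← intervalIntegral.integral_add_adjacent_intervals (hI 0 (1 / z) le_rfl hz2 hz1)
        (hI (1 / z) 1 hz2 hz1 le_rfl)]
    have i1 : ∫ x in (0 : ℝ)..1 / z, min z (1 / x) = ∫ x in (0 : ℝ)..1 / z, z := by
      refine intervalIntegral.integral_congr_uIoo fun x hx => ?_
      rw [Set.uIoo_of_le hz2] at hx
      exact min_eq_left ((le_one_div hz0 hx.1).2 hx.2.le)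
    have i2 : ∫ x in 1 / z..(1 : ℝ), min z (1 / x) = ∫ x in 1 / z..(1 : ℝ), 1 / x := by
      refine intervalIntegral.integral_congr fun x hx => ?_
      rw [Set.uIcc_of_le hz1] at hx
      have hx0 : 0 < x := (one_div_pos.2 hz0).trans_le hx.1
      exact min_eq_right ((one_div_le hx0 hz0).2 hx.1)
    rw [i1, i2, integral_one_div_of_pos (one_div_pos.2 hz0) one_pos]
    simp [capArea, h.le, hz0.ne']

lemma volume_thetaDomain_inter {z : ℝ} (hz : 0 ≤ z) :
    volume (thetaDomain ∩ {p | p.2 ≤ z}) = ENNReal.ofReal (capArea z) := by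
  have hline : ∀ᵐ p : ℝ × ℝ, p.2 ≠ z :=
    Measure.quasiMeasurePreserving_snd.ae (Measure.ae_ne volume z)
  have h1 : (thetaDomain ∩ {p | p.2 ≤ z} : Set (ℝ × ℝ)) =ᵐ[volume]
      regionBetween (fun _ => (0 : ℝ)) (fun x => min z (1 / x)) (Set.Ioo 0 1) := by
    refine eventuallyEq_set.2 ?_
    filter_upwards [hline] with p hne
    constructor
    · rintro ⟨⟨ha, hb, hc⟩, hd⟩
      exact ⟨ha, hb, lt_min (lt_of_le_of_ne hd hne) hc⟩
    · rintro ⟨ha, hb, hc⟩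
      exact ⟨⟨ha, hb, hc.trans_le (min_le_right _ _)⟩, (hc.trans_le (min_le_left _ _)).le⟩
  rw [measure_congr h1]
  change (volume.prod volume) _ = _
  rw [volume_regionBetween_eq_integral (integrableOn_zero) (integrableOn_min_one_div z hz)
    measurableSet_Ioo fun x hx => le_min hz (one_div_pos.2 hx.1).le, ← setIntegral_min_one_div hz]
  simp

/-- The indicator function of the points of the plane at height at most `z`. -/
noncomputable def heightInd (z : ℝ) (p : ℝ × ℝ) : ℝ := if p.2 ≤ z then 1 else 0

lemma measurable_heightInd (z : ℝ) : Measurable (heightInd z) :=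
  Measurable.ite (measurableSet_le measurable_snd measurable_const) measurable_const
    measurable_const

lemma heightInd_eq_indicator (z : ℝ) :
    heightInd z = Set.indicator {p : ℝ × ℝ | p.2 ≤ z} (fun _ => (1 : ℝ)) := by
  funext p
  simp [heightInd, Set.indicator_apply]

lemma integrable_heightInd {z : ℝ} (hz : 0 ≤ z) :
    Integrable (heightInd z) (volume.restrict thetaDomain) := by
  have hm : MeasurableSet {p : ℝ × ℝ | p.2 ≤ z} :=
    measurableSet_le measurable_snd measurable_const
  rw [heightInd_eq_indicator, integrable_indicator_iff hm]
  refine integrableOn_const ?_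
  rw [Measure.restrict_apply hm, Set.inter_comm, volume_thetaDomain_inter hz]
  exact ENNReal.ofReal_ne_top

lemma integral_heightInd {z : ℝ} (hz : 0 ≤ z) :
    ∫ p in thetaDomain, heightInd z p = capArea z := by
  have hm : MeasurableSet {p : ℝ × ℝ | p.2 ≤ z} :=
    measurableSet_le measurable_snd measurable_const
  rw [heightInd_eq_indicator, integral_indicator_const _ hm, measureReal_def,
    Measure.restrict_apply hm, Set.inter_comm, volume_thetaDomain_inter hz,
    ENNReal.toReal_ofReal (capArea_nonneg hz), smul_eq_mul, mul_one]

lemma fareySkew_iterate_fst (n : ℕ) (p : ℝ × ℝ) : (fareySkew^[n] p).1 = fareyMap^[n] p.1 := by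
  induction n with
  | zero => rfl
  | succ n ih =>
    rw [Function.iterate_succ_apply', Function.iterate_succ_apply', ← ih]
    unfold fareySkew fareyMap
    split_ifs <;> rfl

lemma fareySkew_iterate_succ_snd_of_le {p : ℝ × ℝ} {n : ℕ} (h : fareyMap^[n] p.1 ≤ 1 / 2) :
    (fareySkew^[n + 1] p).2 =
      (1 - fareyMap^[n] p.1) + (1 - fareyMap^[n] p.1) ^ 2 * (fareySkew^[n] p).2 := by
  rw [← fareySkew_iterate_fst] at h ⊢
  rw [Function.iterate_succ_apply']
  exact congrArg Prod.snd (if_pos h)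

lemma fareySkew_iterate_succ_snd_of_lt {p : ℝ × ℝ} {n : ℕ} (h : 1 / 2 < fareyMap^[n] p.1) :
    (fareySkew^[n + 1] p).2 =
      fareyMap^[n] p.1 - fareyMap^[n] p.1 ^ 2 * (fareySkew^[n] p).2 := by
  rw [← fareySkew_iterate_fst] at h ⊢
  rw [Function.iterate_succ_apply']
  exact congrArg Prod.snd (if_neg (not_le.2 h))

/-- The approximation coefficients are the heights along the orbit of `(x, 0)`. -/
lemma fareySkew_iterate_snd_eq_thetaF {x : ℝ} (hx : x ∈ Set.Ioo (0 : ℝ) 1) (hirr : Irrational x)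
    (n : ℕ) : (fareySkew^[n] (x, 0)).2 = ThetaF x n := by
  have key : (fareySkew^[n] (x, 0)).2 = sF x n / (sF x n * fareyMap^[n] x + rF x n) := by
    induction n with
    | zero => simp [entries_zero]
    | succ n ih =>
      obtain ⟨hy0, hy1⟩ := (fareyMap_iterate_mem hx hirr n).1
      have hd := denom_pos x n hy0.le
      have hd' := denom_pos x (n + 1) (fareyMap_iterate_mem hx hirr (n + 1)).1.1.le
      rcases le_or_gt (fareyMap^[n] x) (1 / 2) with h | h
      · rw [fareySkew_iterate_succ_snd_of_le h, ih]
        obtain ⟨-, -, h3, h4⟩ := entries_succ_of_le h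
        rw [Function.iterate_succ_apply', fareyMap, if_pos h, h3, h4] at hd' ⊢
        push_cast at hd' ⊢
        generalize fareyMap^[n] x = y at *
        have hy : 1 - y ≠ 0 := by linarith
        have hq := div_mul_cancel₀ (sF x n : ℝ) hd.ne'
        have hw := div_mul_cancel₀ y hy
        rw [eq_div_iff hd'.ne']
        linear_combination (1 + (1 - y) * (sF x n / (sF x n * y + rF x n))) * (sF x n + rF x n) * hw
          + (1 - y) * hq
      · rw [fareySkew_iterate_succ_snd_of_lt h, ih]
        obtain ⟨-, -, h3, h4⟩ := entries_succ_of_lt h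
        rw [Function.iterate_succ_apply', fareyMap, if_neg (not_le.2 h), h3, h4] at hd' ⊢
        push_cast at hd' ⊢
        generalize fareyMap^[n] x = y at *
        have hq := div_mul_cancel₀ (sF x n : ℝ) hd.ne'
        have hw := div_mul_cancel₀ (1 - y) hy0.ne'
        rw [eq_div_iff hd'.ne']
        linear_combination (1 - y * (sF x n / (sF x n * y + rF x n))) * rF x n * hw - y * hq
  have hd := denom_pos x n (fareyMap_iterate_mem hx hirr n).1.1.le
  have hb := fareyBranch_iterate hx hirr n
  have h1 : (sF x n : ℝ) * x - uF x n =
      -(uF x n * rF x n - tF x n * sF x n) / (sF x n * fareyMap^[n] x + rF x n) := by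
    rw [eq_div_iff hd.ne']
    rw [fareyBranch, div_eq_iff hd.ne'] at hb
    linear_combination -(sF x n : ℝ) * hb
  rw [key, ThetaF, h1, abs_div, abs_neg, abs_det_entries, abs_of_pos hd]
  ring

/-- The orbit of `x` under the Farey map visits certain intervals infinitely often. -/
def FareyRecurrent (x : ℝ) : Prop :=
  x ∈ Set.Ioo (0 : ℝ) 1 ∧ Irrational x ∧
    (∀ N, ∃ n ≥ N, fareyMap^[n] x ∈ Set.Ioo (1 / 2 : ℝ) (2 / 3)) ∧
    ∀ k N : ℕ, ∃ n ≥ N, fareyMap^[n] x ∈ Set.Ioo (0 : ℝ) (1 / (k + 2))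

lemma ae_fareyRecurrent :
    ∀ᵐ x ∂(volume : Measure ℝ), x ∈ Set.Ioo (0 : ℝ) 1 → Irrational x → FareyRecurrent x := by
  have h1 : ∀ᵐ x ∂(volume : Measure ℝ), ∀ N, x ∈ Set.Ioo (0 : ℝ) 1 → Irrational x →
      ∃ n ≥ N, fareyMap^[n] x ∈ Set.Ioo (1 / 2 : ℝ) (2 / 3) :=
    ae_all_iff.2 fun N => ae_exists_iterate_mem measurableSet_Ioo
      (Set.Ioo_subset_Ioo (by norm_num) (by norm_num)) (by norm_num [Real.volume_Ioo]) N
  have h2 : ∀ᵐ x ∂(volume : Measure ℝ), ∀ k N : ℕ, x ∈ Set.Ioo (0 : ℝ) 1 → Irrational x →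
      ∃ n ≥ N, fareyMap^[n] x ∈ Set.Ioo (0 : ℝ) (1 / (k + 2)) := by
    refine ae_all_iff.2 fun k => ae_all_iff.2 fun N => ?_
    have hk : (0 : ℝ) < 1 / (k + 2) := by positivity
    refine ae_exists_iterate_mem measurableSet_Ioo (Set.Ioo_subset_Ioo le_rfl ?_) ?_ N
    · rw [div_le_one (by positivity)]
      linarith [Nat.cast_nonneg (α := ℝ) k]
    · rw [Real.volume_Ioo, sub_zero]
      exact (ENNReal.ofReal_pos.2 hk).ne'
  filter_upwards [h1, h2] with x hx1 hx2 hx hirr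
  exact ⟨hx, hirr, fun N => hx1 N hx hirr, fun k N => hx2 k N hx hirr⟩

lemma FareyRecurrent.iterate {x : ℝ} (h : FareyRecurrent x) (m : ℕ) :
    FareyRecurrent (fareyMap^[m] x) := by
  obtain ⟨hx, hirr, h1, h2⟩ := h
  obtain ⟨hm1, hm2⟩ := fareyMap_iterate_mem hx hirr m
  refine ⟨hm1, hm2, fun N => ?_, fun k N => ?_⟩
  · obtain ⟨n, hn, hU⟩ := h1 (N + m)
    refine ⟨n - m, by omega, ?_⟩
    rwa [← Function.iterate_add_apply, Nat.sub_add_cancel (by omega)]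
  · obtain ⟨n, hn, hU⟩ := h2 k (N + m)
    refine ⟨n - m, by omega, ?_⟩
    rwa [← Function.iterate_add_apply, Nat.sub_add_cancel (by omega)]

lemma FareyRecurrent.tendsto_abs_sub {x : ℝ} (h : FareyRecurrent x) (t t' : ℝ) :
    Tendsto (fun n => |(fareySkew^[n] (x, t)).2 - (fareySkew^[n] (x, t')).2|) atTop (𝓝 0) := by
  obtain ⟨hx, hirr, h1, -⟩ := h
  set d : ℕ → ℝ := fun n => |(fareySkew^[n] (x, t)).2 - (fareySkew^[n] (x, t')).2| with hd
  have hd0 : ∀ n, 0 ≤ d n := fun n => abs_nonneg _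
  have hright : ∀ n, 1 / 2 < fareyMap^[n] x → d (n + 1) = fareyMap^[n] x ^ 2 * d n := by
    intro n hn
    simp only [hd]
    rw [fareySkew_iterate_succ_snd_of_lt hn, fareySkew_iterate_succ_snd_of_lt hn,
      sub_sub_sub_cancel_left, ← mul_sub, abs_mul, abs_of_nonneg (sq_nonneg _), abs_sub_comm]
  have hleft : ∀ n, fareyMap^[n] x ≤ 1 / 2 → d (n + 1) = (1 - fareyMap^[n] x) ^ 2 * d n := by
    intro n hn
    simp only [hd]
    rw [fareySkew_iterate_succ_snd_of_le hn, fareySkew_iterate_succ_snd_of_le hn,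
      add_sub_add_left_eq_sub, ← mul_sub, abs_mul, abs_of_nonneg (sq_nonneg _)]
  have hanti : Antitone d := by
    refine antitone_nat_of_succ_le fun n => ?_
    obtain ⟨hy0, hy1⟩ := (fareyMap_iterate_mem hx hirr n).1
    rcases le_or_gt (fareyMap^[n] x) (1 / 2) with h | h
    · rw [hleft n h]
      exact mul_le_of_le_one_left (hd0 n) (by nlinarith)
    · rw [hright n h]
      exact mul_le_of_le_one_left (hd0 n) (by nlinarith)
  have hbdd : BddBelow (Set.range d) := ⟨0, by rintro _ ⟨n, rfl⟩; exact hd0 n⟩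
  have hlim := tendsto_atTop_ciInf hanti hbdd
  have hL0 : 0 ≤ ⨅ n, d n := le_ciInf hd0
  have hle : ∀ n, ⨅ n, d n ≤ d n := ciInf_le hbdd
  generalize (⨅ n, d n) = L at *
  rcases hL0.eq_or_lt with rfl | hL
  · exact hlim
  · obtain ⟨N, hN⟩ := eventually_atTop.1 (hlim.eventually (gt_mem_nhds (by linarith : L < 2 * L)))
    obtain ⟨n, hn, hn1, hn2⟩ := h1 N
    have h2 := hN n hn
    have h3 := hle (n + 1)
    rw [hright n hn1] at h3
    have h4 : fareyMap^[n] x ^ 2 ≤ 4 / 9 := by nlinarith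
    have h5 := mul_le_mul_of_nonneg_right h4 (hd0 n)
    linarith

/-- The number of visits to height at most `z` during the first `n` steps of the orbit of `p`. -/
noncomputable def thetaCount (z : ℝ) (p : ℝ × ℝ) (n : ℕ) : ℝ :=
  birkhoffSum fareySkew (heightInd z) n p

lemma heightInd_nonneg (z : ℝ) (p : ℝ × ℝ) : 0 ≤ heightInd z p := by
  unfold heightInd
  split_ifs <;> norm_num

lemma heightInd_le_one (z : ℝ) (p : ℝ × ℝ) : heightInd z p ≤ 1 := by
  unfold heightInd
  split_ifs <;> norm_num

lemma thetaCount_mono (z : ℝ) (p : ℝ × ℝ) : Monotone (thetaCount z p) :=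
  monotone_nat_of_le_succ fun n => by
    simp only [thetaCount, birkhoffSum_succ]
    exact le_add_of_nonneg_right (heightInd_nonneg _ _)

lemma thetaCount_add (z : ℝ) (p : ℝ × ℝ) (m n : ℕ) :
    thetaCount z p (m + n) = thetaCount z p m + thetaCount z (fareySkew^[m] p) n :=
  birkhoffSum_add _ _ _ _ _

lemma thetaCount_nonneg (z : ℝ) (p : ℝ × ℝ) (n : ℕ) : 0 ≤ thetaCount z p n := by
  unfold thetaCount birkhoffSum
  exact Finset.sum_nonneg fun _ _ => heightInd_nonneg _ _

lemma thetaCount_le (z : ℝ) (p : ℝ × ℝ) (n : ℕ) : thetaCount z p n ≤ n := by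
  unfold thetaCount birkhoffSum
  simpa using Finset.sum_le_card_nsmul (Finset.range n)
    (fun k => heightInd z (fareySkew^[k] p)) 1 fun k _ => heightInd_le_one z _

lemma FareyRecurrent.thetaCount_le_add {x : ℝ} (h : FareyRecurrent x) (t t' : ℝ) {z z' : ℝ}
    (hz : z < z') : ∃ C, ∀ n, thetaCount z (x, t) n ≤ thetaCount z' (x, t') n + C := by
  obtain ⟨N, hN⟩ := eventually_atTop.1
    ((h.tendsto_abs_sub t t').eventually (gt_mem_nhds (sub_pos.2 hz)))
  have hstep : ∀ n ≥ N,
      heightInd z (fareySkew^[n] (x, t)) ≤ heightInd z' (fareySkew^[n] (x, t')) := by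
    intro n hn
    have h1 := (abs_lt.1 (hN n hn)).1
    unfold heightInd
    split_ifs with h2 h3
    · exact le_rfl
    · linarith
    · exact zero_le_one
    · exact le_rfl
  refine ⟨N, fun n => ?_⟩
  have h0 := thetaCount_nonneg z' (x, t') n
  rcases le_total n N with hn | hn
  · have h1 := thetaCount_le z (x, t) n
    have h2 : (n : ℝ) ≤ N := by exact_mod_cast hn
    linarith
  · induction n, hn using Nat.le_induction with
    | base => linarith [thetaCount_le z (x, t) N]
    | succ n hn ih =>
      have h1 := ih (thetaCount_nonneg _ _ _)
      have h2 := hstep n hn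
      simp only [thetaCount, birkhoffSum_succ] at h1 ⊢
      linarith

lemma FareyRecurrent.exists_snd_le {x : ℝ} (h : FareyRecurrent x) {b : ℝ} (hb : 0 < b) (N : ℕ) :
    ∃ n ≥ N, (fareySkew^[n] (x, 0)).2 ≤ b := by
  obtain ⟨hx, hirr, -, h2⟩ := h
  have hinv : ∀ n, 0 ≤ (fareySkew^[n] (x, 0)).2 ∧
      fareyMap^[n] x * (fareySkew^[n] (x, 0)).2 ≤ 1 := by
    intro n
    induction n with
    | zero => simp
    | succ n ih =>
      obtain ⟨hy0, hy1⟩ := (fareyMap_iterate_mem hx hirr n).1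
      have hy2 : 0 < 1 - fareyMap^[n] x := by linarith
      rw [Function.iterate_succ_apply' fareyMap, fareyMap]
      rcases le_or_gt (fareyMap^[n] x) (1 / 2) with h | h
      · rw [fareySkew_iterate_succ_snd_of_le h, if_pos h]
        dsimp only
        generalize fareyMap^[n] x = y at *
        generalize (fareySkew^[n] (x, 0)).2 = s at *
        refine ⟨by have := ih.1; positivity, ?_⟩
        have : y / (1 - y) * (1 - y + (1 - y) ^ 2 * s) = y + (1 - y) * (y * s) := by
          field_simp
        nlinarith [ih.2]
      · rw [fareySkew_iterate_succ_snd_of_lt h, if_neg (not_le.2 h)]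
        dsimp only
        generalize fareyMap^[n] x = y at *
        generalize (fareySkew^[n] (x, 0)).2 = s at *
        refine ⟨by nlinarith [ih.2], ?_⟩
        have : (1 - y) / y * (y - y ^ 2 * s) = (1 - y) * (1 - y * s) := by
          field_simp
        have h3 : 0 ≤ y * s := mul_nonneg hy0.le ih.1
        nlinarith [ih.2]
  obtain ⟨k, hk⟩ := exists_nat_one_div_lt hb
  obtain ⟨n, hn, hn0, hn1⟩ := h2 k N
  have hex := exists_half_lt_iterate hx hirr n
  have hconst : ∀ j, (∀ i < j, fareyMap^[n + i] x ≤ 1 / 2) →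
      fareyMap^[n + j] x * (1 - fareyMap^[n + j] x * (fareySkew^[n + j] (x, 0)).2) =
        fareyMap^[n] x * (1 - fareyMap^[n] x * (fareySkew^[n] (x, 0)).2) := by
    intro j
    induction j with
    | zero => simp
    | succ j ih =>
      intro hj
      have hj' := hj j (Nat.lt_succ_self j)
      rw [← ih fun i hi => hj i (hi.trans (Nat.lt_succ_self j)), ← add_assoc,
        fareySkew_iterate_succ_snd_of_le hj', Function.iterate_succ_apply' fareyMap, fareyMap,
        if_pos hj']
      dsimp only
      have hy1 : 1 - fareyMap^[n + j] x ≠ 0 := by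
        have := (fareyMap_iterate_mem hx hirr (n + j)).1.2
        linarith
      field_simp
      ring
  have hex' : ∃ j, 1 / 2 < fareyMap^[n + j] x := by
    obtain ⟨m, hm, hm'⟩ := hex
    exact ⟨m - n, by rwa [Nat.add_sub_cancel' hm]⟩
  have hj := Nat.find_spec hex'
  have hq := hconst (Nat.find hex') fun i hi => not_lt.1 (Nat.find_min hex' hi)
  refine ⟨n + Nat.find hex' + 1, by omega, ?_⟩
  rw [fareySkew_iterate_succ_snd_of_lt hj]
  dsimp only
  have h3 : (1 : ℝ) / (k + 2) ≤ 1 / (k + 1) :=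
    one_div_le_one_div_of_le (by positivity) (by linarith)
  have h4 := mul_nonneg hn0.le (mul_nonneg hn0.le (hinv n).1)
  linarith

lemma FareyRecurrent.tendsto_thetaCount {x : ℝ} (h : FareyRecurrent x) {b : ℝ} (hb : 0 < b) :
    Tendsto (thetaCount b (x, 0)) atTop atTop := by
  have key : ∀ k : ℕ, ∃ n, (k : ℝ) ≤ thetaCount b (x, 0) n := by
    intro k
    induction k with
    | zero => exact ⟨0, by simp [thetaCount]⟩
    | succ k ih =>
      obtain ⟨N, hN⟩ := ih
      obtain ⟨n, hn, hnb⟩ := h.exists_snd_le hb N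
      refine ⟨n + 1, ?_⟩
      have h1 := thetaCount_mono b (x, 0) hn
      have h2 : heightInd b (fareySkew^[n] (x, 0)) = 1 := if_pos hnb
      rw [thetaCount, birkhoffSum_succ, h2, ← thetaCount]
      push_cast
      linarith
  refine tendsto_atTop_atTop_of_monotone (thetaCount_mono _ _) fun c => ?_
  obtain ⟨k, hk⟩ := exists_nat_ge c
  obtain ⟨n, hn⟩ := key k
  exact ⟨n, hk.trans hn⟩

lemma measurable_thetaCount (z : ℝ) (n : ℕ) : Measurable fun p => thetaCount z p n := by
  unfold thetaCount birkhoffSum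
  exact Finset.measurable_sum _ fun k _ =>
    (measurable_heightInd z).comp (measurable_fareySkew.iterate k)

lemma thetaCount_le_of_le {z z' : ℝ} (h : z ≤ z') (p : ℝ × ℝ) (n : ℕ) :
    thetaCount z p n ≤ thetaCount z' p n := by
  unfold thetaCount birkhoffSum
  refine Finset.sum_le_sum fun k _ => ?_
  unfold heightInd
  split_ifs <;> linarith

lemma ae_eventually_thetaCount_le {a b r : ℝ} (ha : 0 ≤ a) (hb : 0 < b) (hr : 0 < r)
    (hab : capArea a < r * capArea b) :
    ∀ᵐ x ∂(volume : Measure ℝ), x ∈ Set.Ioo (0 : ℝ) 1 → Irrational x →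
      ∀ᶠ n in atTop, thetaCount a (x, 0) n ≤ r * thetaCount b (x, 0) n := by
  obtain ⟨ε, hε, hεb, hεr, hcap⟩ : ∃ ε > 0, ε < b ∧ ε < r ∧
      capArea (a + ε) < (r - ε) * capArea (b - ε) := by
    have hc : Continuous fun ε => (r - ε) * capArea (b - ε) - capArea (a + ε) :=
      ((continuous_const.sub continuous_id).mul
        (continuous_capArea.comp (continuous_const.sub continuous_id))).sub
        (continuous_capArea.comp (continuous_const.add continuous_id))
    have h1 : ∀ᶠ ε in 𝓝 (0 : ℝ), 0 < (r - ε) * capArea (b - ε) - capArea (a + ε) :=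
      hc.continuousAt.eventually (lt_mem_nhds (by simpa using hab))
    have h2 := ((h1.and ((gt_mem_nhds hb).and (gt_mem_nhds hr))).filter_mono
      (nhdsWithin_le_nhds (s := Set.Ioi 0))).and self_mem_nhdsWithin
    obtain ⟨ε, ⟨h3, h4, h5⟩, h6⟩ := h2.exists
    exact ⟨ε, h6, h4, h5, sub_pos.1 h3⟩
  let B : Set ℝ := Set.Ioo (0 : ℝ) 1 ∩
    {x | ∃ᶠ n in atTop, r * thetaCount b (x, 0) n < thetaCount a (x, 0) n}
  have hBm : MeasurableSet B := by
    refine measurableSet_Ioo.inter ?_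
    have : {x | ∃ᶠ n in atTop, r * thetaCount b (x, 0) n < thetaCount a (x, 0) n} =
        ⋂ N : ℕ, ⋃ n : ℕ, ⋃ _ : n ≥ N,
          {x | r * thetaCount b (x, 0) n < thetaCount a (x, 0) n} := by
      ext x
      simp [frequently_atTop]
    rw [this]
    have hm : ∀ z n, Measurable fun x : ℝ => thetaCount z (x, 0) n := fun z n =>
      (measurable_thetaCount z n).comp (measurable_id.prodMk measurable_const)
    exact .iInter fun N => .iUnion fun n => .iUnion fun _ =>
      measurableSet_lt ((hm b n).const_mul r) (hm a n)
  have hB : volume B = 0 := by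
    by_contra hpos
    let h : ℝ × ℝ → ℝ := fun p => heightInd (a + ε) p - (r - ε) * heightInd (b - ε) p
    have hsum : ∀ n p, birkhoffSum fareySkew h n p =
        thetaCount (a + ε) p n - (r - ε) * thetaCount (b - ε) p n := by
      intro n p
      simp only [thetaCount, birkhoffSum, h, Finset.sum_sub_distrib, Finset.mul_sum]
    have hx : ∀ᵐ x ∂(volume : Measure ℝ), x ∈ Set.Ioo (0 : ℝ) 1 → Irrational x →
        ∀ t, ∃ n, 0 < birkhoffSum fareySkew h n (x, t) := by
      filter_upwards [ae_exists_iterate_mem hBm Set.inter_subset_left hpos 0,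
        ae_fareyRecurrent] with x h1 h2 hx hirr t
      obtain ⟨m, -, -, hfreq⟩ := h1 hx hirr
      have hrec := (h2 hx hirr).iterate m
      have hp : fareySkew^[m] (x, t) = (fareyMap^[m] x, (fareySkew^[m] (x, t)).2) :=
        Prod.ext (fareySkew_iterate_fst m (x, t)) rfl
      obtain ⟨C₁, hC₁⟩ := hrec.thetaCount_le_add 0 (fareySkew^[m] (x, t)).2
        (lt_add_of_pos_right a hε)
      obtain ⟨C₂, hC₂⟩ := hrec.thetaCount_le_add (fareySkew^[m] (x, t)).2 0
        (sub_lt_self b hε)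
      rw [← hp] at hC₁ hC₂
      obtain ⟨n, hn1, hn2⟩ := (hfreq.and_eventually ((hrec.tendsto_thetaCount hb).eventually_gt_atTop
        ((C₁ + (r - ε) * (m + C₂)) / ε))).exists
      rw [div_lt_iff₀ hε] at hn2
      refine ⟨m + n, ?_⟩
      rw [hsum, thetaCount_add, thetaCount_add]
      have e1 := hC₁ n
      have e2 := hC₂ n
      have e3 := thetaCount_nonneg (a + ε) (x, t) m
      have e4 := thetaCount_le (b - ε) (x, t) m
      have e5 := mul_le_mul_of_nonneg_left (add_le_add e4 e2) (sub_pos.2 hεr).le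
      linarith
    have hae : ∀ᵐ p ∂(volume.restrict thetaDomain), ∃ n, 0 < birkhoffSum fareySkew h n p := by
      rw [ae_restrict_iff' measurableSet_thetaDomain]
      have hirr : ∀ᵐ x ∂(volume : Measure ℝ), Irrational x :=
        (Set.countable_range ((↑) : ℚ → ℝ)).ae_notMem volume
      have h3 := Measure.quasiMeasurePreserving_fst (μ := (volume : Measure ℝ))
        (ν := (volume : Measure ℝ)) |>.ae (hx.and hirr)
      filter_upwards [h3] with p hp hpD
      exact hp.1 hpD.1 hp.2 p.2
    have ha' : 0 ≤ a + ε := by linarith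
    have hb' : 0 ≤ b - ε := by linarith
    have hi₁ := integrable_heightInd ha'
    have hi₂ := (integrable_heightInd hb').const_mul (r - ε)
    have hge := integral_nonneg_of_ae_exists_birkhoffSum_pos measurable_fareySkew
      lintegral_fareySkew_le
      ((measurable_heightInd (a + ε)).sub ((measurable_heightInd (b - ε)).const_mul (r - ε)))
      (hi₁.sub hi₂) hae
    rw [integral_sub' hi₁ hi₂, integral_const_mul, integral_heightInd ha',
      integral_heightInd hb'] at hge
    linarith
  filter_upwards [measure_eq_zero_iff_ae_notMem.1 hB] with x hxB hx hirr
  have hnot : ¬ ∃ᶠ n in atTop, r * thetaCount b (x, 0) n < thetaCount a (x, 0) n :=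
    fun hf => hxB ⟨hx, hf⟩
  exact (not_frequently.1 hnot).mono fun n hn => not_lt.1 hn

lemma ae_forall_eventually_thetaCount_le :
    ∀ᵐ x ∂(volume : Measure ℝ), x ∈ Set.Ioo (0 : ℝ) 1 → Irrational x →
      ∀ a b r : ℝ, 0 ≤ a → 0 < b → 0 < r → capArea a < r * capArea b →
      ∀ᶠ n in atTop, thetaCount a (x, 0) n ≤ r * thetaCount b (x, 0) n := by
  have h : ∀ᵐ x ∂(volume : Measure ℝ), ∀ a b r : ℚ, (0 : ℝ) ≤ a → (0 : ℝ) < b → (0 : ℝ) < r →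
      capArea a < r * capArea b → x ∈ Set.Ioo (0 : ℝ) 1 → Irrational x →
      ∀ᶠ n in atTop, thetaCount a (x, 0) n ≤ r * thetaCount b (x, 0) n := by
    simp only [ae_all_iff]
    exact fun a b r ha hb hr hab => ae_eventually_thetaCount_le ha hb hr hab
  filter_upwards [h] with x hx h01 hirr a b r ha hb hr hab
  have hb0 := capArea_pos hb
  obtain ⟨r', hr'1, hr'2⟩ := exists_rat_btwn ((div_lt_iff₀ hb0).2 hab)
  have hr'0 : (0 : ℝ) < r' := (div_nonneg (capArea_nonneg ha) hb0.le).trans_lt hr'1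
  rw [div_lt_iff₀ hb0] at hr'1
  obtain ⟨c, hc1, hc2⟩ := exists_between hr'1
  obtain ⟨a₁, ha₁, hsa⟩ := mem_nhdsGT_iff_exists_Ioo_subset.1 (nhdsWithin_le_nhds
    (s := Set.Ioi a) (continuous_capArea.continuousAt.eventually (gt_mem_nhds hc1)))
  obtain ⟨a', ha'1, ha'2⟩ := exists_rat_btwn (Set.mem_Ioi.1 ha₁)
  obtain ⟨b₁, hb₁, hsb⟩ := mem_nhdsLT_iff_exists_Ioo_subset.1 (nhdsWithin_le_nhds
    (s := Set.Iio b) (((continuous_const (y := (r' : ℝ))).mul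
      continuous_capArea).continuousAt.eventually (lt_mem_nhds hc2)))
  obtain ⟨b', hb'1, hb'2⟩ := exists_rat_btwn (max_lt (Set.mem_Iio.1 hb₁) hb)
  have hca : capArea a' < c := hsa ⟨ha'1, ha'2⟩
  have hcb : c < r' * capArea b' := hsb ⟨(le_max_left _ _).trans_lt hb'1, hb'2⟩
  filter_upwards [hx a' b' r' (ha.trans ha'1.le) ((le_max_right _ _).trans_lt hb'1) hr'0
    (hca.trans hcb) h01 hirr] with n hn
  calc thetaCount a (x, 0) n ≤ thetaCount a' (x, 0) n := thetaCount_le_of_le ha'1.le _ _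
    _ ≤ r' * thetaCount b' (x, 0) n := hn
    _ ≤ r * thetaCount b (x, 0) n :=
      mul_le_mul hr'2.le (thetaCount_le_of_le hb'2.le _ _) (thetaCount_nonneg _ _ _) hr.le

lemma tendsto_thetaCount_div {x : ℝ} (hrec : FareyRecurrent x)
    (h : ∀ a b r : ℝ, 0 ≤ a → 0 < b → 0 < r → capArea a < r * capArea b →
      ∀ᶠ n in atTop, thetaCount a (x, 0) n ≤ r * thetaCount b (x, 0) n)
    {z z₀ : ℝ} (hz : 0 ≤ z) (hz₀ : 0 < z₀) :
    Tendsto (fun n => thetaCount z (x, 0) n / thetaCount z₀ (x, 0) n) atTop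
      (𝓝 (capArea z / capArea z₀)) := by
  have hpos := (hrec.tendsto_thetaCount hz₀).eventually_gt_atTop 0
  have hc₀ := capArea_pos hz₀
  refine tendsto_order.2 ⟨fun u hu => ?_, fun u hu => ?_⟩
  · rcases lt_or_ge u 0 with hu0 | hu0
    · filter_upwards [hpos] with n hn
      exact hu0.trans_le (div_nonneg (thetaCount_nonneg _ _ _) hn.le)
    · obtain ⟨v, huv, hv⟩ := exists_between hu
      have hv0 : 0 < v := hu0.trans_lt huv
      rw [lt_div_iff₀ hc₀] at hv
      have hz' : 0 < z := by
        refine lt_of_le_of_ne hz ?_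
        rintro rfl
        have : capArea 0 = 0 := by simp [capArea]
        rw [this] at hv
        exact absurd hv (mul_pos hv0 hc₀).not_gt
      have hv' : capArea z₀ < v⁻¹ * capArea z := (lt_inv_mul_iff₀ hv0).2 hv
      filter_upwards [hpos, h z₀ z v⁻¹ hz₀.le hz' (inv_pos.2 hv0) hv'] with n hn hle
      rw [le_inv_mul_iff₀ hv0] at hle
      rw [lt_div_iff₀ hn]
      exact (mul_lt_mul_of_pos_right huv hn).trans_le hle
  · obtain ⟨v, hv, hvu⟩ := exists_between hu
    have hv0 : 0 < v := (div_nonneg (capArea_nonneg hz) hc₀.le).trans_lt hv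
    rw [div_lt_iff₀ hc₀] at hv
    filter_upwards [hpos, h z z₀ v hz hz₀ hv0 hv] with n hn hle
    rw [div_lt_iff₀ hn]
    exact hle.trans_lt (mul_lt_mul_of_pos_right hvu hn)

lemma capArea_div_capArea {z z₀ : ℝ} (hzz : z ≤ z₀) :
    capArea z / capArea z₀ = if z₀ ≤ 1 then z / z₀
      else if z ≤ 1 then z / (1 + Real.log z₀)
      else (1 + Real.log z) / (1 + Real.log z₀) := by
  split_ifs with h1 h2
  · simp [capArea, h1, hzz.trans h1]
  · simp [capArea, (not_le.1 h1).le, h2]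
  · simp [capArea, (not_le.1 h1).le, (not_le.1 h2).le]

lemma card_filter_range_nth {P Q : ℕ → Prop} (hP : {n | P n}.Infinite) (hQP : ∀ n, Q n → P n)
    (m : ℕ) :
    ((Finset.range m).filter fun k => Q (Nat.nth P k)).card =
      ((Finset.range (Nat.nth P m)).filter Q).card := by
  have hmono := Nat.nth_strictMono hP
  rw [← Finset.card_image_of_injective _ hmono.injective]
  congr 1
  ext i
  simp only [Finset.mem_image, Finset.mem_filter, Finset.mem_range]
  constructor
  · rintro ⟨k, ⟨hk, hQ⟩, rfl⟩
    exact ⟨hmono hk, hQ⟩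
  · rintro ⟨hi, hQ⟩
    have hc := Nat.nth_count (hQP i hQ)
    refine ⟨Nat.count P i, ⟨hmono.lt_iff_lt.1 (hc.trans_lt hi), hc.symm ▸ hQ⟩, hc⟩

lemma thetaCount_eq_card {x : ℝ} (hx : x ∈ Set.Ioo (0 : ℝ) 1) (hirr : Irrational x) (z : ℝ)
    (n : ℕ) :
    thetaCount z (x, 0) n = ((Finset.range n).filter fun k => ThetaF x k ≤ z).card := by
  unfold thetaCount birkhoffSum heightInd
  simp only [fareySkew_iterate_snd_eq_thetaF hx hirr, Finset.sum_boole]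

/-- For a.e. irrational `x ∈ (0,1)`, the Farey convergents with `Θ_n(x) ≤ z₀` are infinite
in number and, enumerated in order, their approximation coefficients have the stated
limiting distribution. -/
theorem stmt_10 (z₀ : ℝ) (hz₀ : 0 < z₀) :
    ∀ᵐ x ∂(volume : Measure ℝ), x ∈ Set.Ioo (0:ℝ) 1 → Irrational x →
      {n : ℕ | ThetaF x n ≤ z₀}.Infinite ∧
      ∀ z : ℝ, 0 ≤ z → z ≤ z₀ →
        Tendsto (fun m : ℕ =>
            (((Finset.range m).filter fun k =>
                ThetaF x (Nat.nth (fun n => ThetaF x n ≤ z₀) k) ≤ z).card : ℝ) / (m : ℝ))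
          atTop (𝓝 (if z₀ ≤ 1 then z / z₀
                    else if z ≤ 1 then z / (1 + Real.log z₀)
                    else (1 + Real.log z) / (1 + Real.log z₀))) := by
  filter_upwards [ae_fareyRecurrent, ae_forall_eventually_thetaCount_le] with x h1 h2 hx hirr
  have hrec := h1 hx hirr
  have hinf : {n : ℕ | ThetaF x n ≤ z₀}.Infinite := by
    refine Nat.frequently_atTop_iff_infinite.1 (frequently_atTop.2 fun N => ?_)
    obtain ⟨n, hn, hle⟩ := hrec.exists_snd_le hz₀ N
    exact ⟨n, hn, fareySkew_iterate_snd_eq_thetaF hx hirr n ▸ hle⟩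
  refine ⟨hinf, fun z hz hzz => ?_⟩
  rw [← capArea_div_capArea hzz]
  refine ((tendsto_thetaCount_div hrec (h2 hx hirr) hz hz₀).comp
    (Nat.nth_strictMono hinf).tendsto_atTop).congr fun m => ?_
  have hden : thetaCount z₀ (x, 0) (Nat.nth (fun n => ThetaF x n ≤ z₀) m) = m := by
    rw [thetaCount_eq_card hx hirr, ← card_filter_range_nth hinf fun _ h => h,
      Finset.filter_true_of_mem fun k _ => Nat.nth_mem_of_infinite hinf k, Finset.card_range]
  rw [Function.comp_apply, hden, thetaCount_eq_card hx hirr,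
    ← card_filter_range_nth hinf fun _ h => h.trans hzz]
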